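/- arXiv:2408.01097 — 7 statements merged into one kernel-verified Lean document; each statement's English description precedes it below -/
import Mathlib

section
/- Let α ∈ (0,1), s ≥ 3, B > 0, I ⊆ ℝ an interval, and let u : I → (ℤ → ℂ) be a Fourier solution of ∂_t u = −i|D|^α u + |u|²u_x on the torus with sup_{t∈I} ‖u(t)‖_s ≤ B. Then the mass ∑_{k∈ℤ} |u_k(t)|² and the momentum ∑_{k∈ℤ} k |u_k(t)|² are finite and independent of t ∈ I. -/
noncomputable section

/-- Sobolev weight `⟨k⟩^{2s} = max(1,|k|)^{2s}`. -/
def sobWeight (s : ℝ) (k : ℤ) : ℝ := (max 1 |(k : ℝ)|) ^ (2 * s)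

/-- Square of the `H^s(𝕋)` norm of a Fourier sequence. -/
def sobNormSq (s : ℝ) (u : ℤ → ℂ) : ℝ := ∑' k : ℤ, sobWeight s k * ‖u k‖ ^ 2

/-- The `H^s(𝕋)` norm of a Fourier sequence. -/
def sobNorm (s : ℝ) (u : ℤ → ℂ) : ℝ := Real.sqrt (sobNormSq s u)

/-- Finiteness of the `H^s` norm, i.e. `∑_k ⟨k⟩^{2s} |u_k|² < ∞`. -/
def HasSobNorm (s : ℝ) (u : ℤ → ℂ) : Prop :=
  Summable fun k : ℤ => sobWeight s k * ‖u k‖ ^ 2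

/-- Absolute convergence of the cubic convolution sum at frequency `k`:
`∑_{k₁-k₂+k₃=k} |k₃| |u_{k₁}| |u_{k₂}| |u_{k₃}| < ∞`. -/
def CubicSummable (u : ℤ → ℂ) (k : ℤ) : Prop :=
  Summable fun p : {p : ℤ × ℤ × ℤ // p.1 - p.2.1 + p.2.2 = k} =>
    |(p.1.2.2 : ℝ)| * ‖u p.1.1‖ * ‖u p.1.2.1‖ * ‖u p.1.2.2‖

/-- The cubic convolution sum `∑_{k₁-k₂+k₃=k} k₃ u_{k₁} \bar u_{k₂} u_{k₃}`. -/
def cubicSum (u : ℤ → ℂ) (k : ℤ) : ℂ :=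
  ∑' p : {p : ℤ × ℤ × ℤ // p.1 - p.2.1 + p.2.2 = k},
    (p.1.2.2 : ℂ) * u p.1.1 * (starRingEnd ℂ) (u p.1.2.1) * u p.1.2.2

/-- `u` is a Fourier solution of `∂ₜ u = - i |D|^α u + |u|² u_x` on the time set `I`. -/
def IsFourierSolution (α : ℝ) (I : Set ℝ) (u : ℝ → ℤ → ℂ) : Prop :=
  ∀ k : ℤ, ∀ t ∈ I,
    CubicSummable (u t) k ∧
      HasDerivWithinAt (fun τ => u τ k)
        (-Complex.I * Complex.ofReal (|(k : ℝ)| ^ α) * u t k +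
          Complex.I * cubicSum (u t) k) I t


/-- Summable majorant `max(1,|k|)^{-2}`. -/
def majG (k : ℤ) : ℝ := ((max 1 |(k : ℝ)|) ^ 2)⁻¹

lemma majG_pos (k : ℤ) : 0 < majG k := by
  unfold majG
  have : (0 : ℝ) < max 1 |(k : ℝ)| := lt_of_lt_of_le one_pos (le_max_left _ _)
  positivity

lemma majG_le_one (k : ℤ) : majG k ≤ 1 := by
  unfold majG
  exact inv_le_one_of_one_le₀ (one_le_pow₀ (le_max_left _ _))

lemma majG_summable : Summable majG := by
  have h : Summable fun n : ℤ => 1 / (n : ℝ) ^ 2 :=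
    Real.summable_one_div_int_pow.mpr (by norm_num)
  refine h.of_norm_bounded_eventually ?_
  have hf : ({0} : Set ℤ).Finite := Set.finite_singleton 0
  filter_upwards [hf.compl_mem_cofinite] with k hk
  have hk0 : (k : ℝ) ≠ 0 := by
    have : k ≠ 0 := by simpa using hk
    exact_mod_cast this
  rw [Real.norm_of_nonneg (majG_pos k).le, majG, one_div]
  apply inv_anti₀
  · positivity
  · rw [← sq_abs]
    gcongr
    exact le_max_right _ _

lemma majG3_summable :
    Summable fun p : ℤ × ℤ × ℤ => majG p.1 * (majG p.2.1 * majG p.2.2) := by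
  have h2 : Summable fun p : ℤ × ℤ => majG p.1 * majG p.2 :=
    majG_summable.mul_of_nonneg majG_summable (fun k => (majG_pos k).le) (fun k => (majG_pos k).le)
  exact majG_summable.mul_of_nonneg h2 (fun k => (majG_pos k).le)
    (fun k => (mul_pos (majG_pos _) (majG_pos _)).le)

/-- Pointwise decay from the Sobolev bound. -/
lemma sob_decay {s B : ℝ} (hs : 3 ≤ s) (hB : 0 < B) {u : ℤ → ℂ}
    (h1 : HasSobNorm s u) (h2 : sobNorm s u ≤ B) (k : ℤ) :
    max 1 |(k : ℝ)| * ‖u k‖ ≤ B * majG k := by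
  set m : ℝ := max 1 |(k : ℝ)| with hm
  have hm1 : (1 : ℝ) ≤ m := le_max_left _ _
  have hmpos : 0 < m := lt_of_lt_of_le one_pos hm1
  have hw : ∀ j : ℤ, 0 ≤ sobWeight s j * ‖u j‖ ^ 2 := fun j => by
    unfold sobWeight; positivity
  have hle : sobWeight s k * ‖u k‖ ^ 2 ≤ sobNormSq s u := h1.le_tsum k (fun j _ => hw j)
  have hsq : sobNormSq s u ≤ B ^ 2 := by
    unfold sobNorm at h2
    exact (Real.sqrt_le_left hB.le).mp h2
  have h6 : m ^ 6 ≤ sobWeight s k := by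
    unfold sobWeight
    rw [← hm, ← Real.rpow_natCast]
    exact Real.rpow_le_rpow_of_exponent_le hm1 (by push_cast; linarith)
  have h7 : (m ^ 3 * ‖u k‖) ^ 2 ≤ B ^ 2 := by
    calc (m ^ 3 * ‖u k‖) ^ 2 = m ^ 6 * ‖u k‖ ^ 2 := by ring
      _ ≤ sobWeight s k * ‖u k‖ ^ 2 := by gcongr
      _ ≤ B ^ 2 := hle.trans hsq
  have h8 : m ^ 3 * ‖u k‖ ≤ B := abs_le_of_sq_le_sq h7 hB.le |> le_trans (le_abs_self _)
  unfold majG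
  rw [← hm, ← div_eq_mul_inv, le_div_iff₀ (by positivity)]
  calc m * ‖u k‖ * m ^ 2 = m ^ 3 * ‖u k‖ := by ring
    _ ≤ B := h8

/-- A sum of functions with dominated derivatives adding up to zero is constant. -/
lemma tsum_const_of_deriv {I : Set ℝ} (hI : I.OrdConnected) (f f' : ℤ → ℝ → ℝ) (C : ℤ → ℝ)
    (hC : Summable C) (hd : ∀ k, ∀ t ∈ I, HasDerivWithinAt (f k) (f' k t) I t)
    (hb : ∀ k, ∀ t ∈ I, |f' k t| ≤ C k) (hsum : ∀ t ∈ I, Summable fun k => f k t)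
    (h0 : ∀ t ∈ I, ∑' k, f' k t = 0) {t t' : ℝ} (ht : t ∈ I) (ht' : t' ∈ I) :
    ∑' k, f k t = ∑' k, f k t' := by
  have hconv : Convex ℝ I := hI.convex
  have key : ∀ S : Finset ℤ, |∑ k ∈ S, f k t - ∑ k ∈ S, f k t'| ≤
      (∑' k : {k // k ∉ S}, C k) * |t - t'| := by
    intro S
    refine hconv.norm_image_sub_le_of_norm_hasDerivWithin_le (f := fun τ => ∑ k ∈ S, f k τ)
      (f' := fun τ => ∑ k ∈ S, f' k τ) ?_ ?_ ht' ht
    · intro x hx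
      exact HasDerivWithinAt.fun_sum fun k _ => hd k x hx
    · intro x hx
      have hs' : Summable fun k => f' k x := hC.of_norm_bounded (fun k => hb k x hx)
      have e := hs'.sum_add_tsum_subtype_compl S
      rw [h0 x hx] at e
      have e2 : ∑ k ∈ S, f' k x = - ∑' k : {k // k ∉ S}, f' k x := by linarith
      rw [e2, norm_neg]
      exact tsum_of_norm_bounded (hC.subtype _).hasSum (fun k => hb k x hx)
  have hl : Filter.Tendsto (fun S : Finset ℤ => |∑ k ∈ S, f k t - ∑ k ∈ S, f k t'|)
      Filter.atTop (nhds |∑' k, f k t - ∑' k, f k t'|) :=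
    (Filter.Tendsto.sub (hsum t ht).hasSum (hsum t' ht').hasSum).abs
  have hr : Filter.Tendsto (fun S : Finset ℤ => (∑' k : {k // k ∉ S}, C k) * |t - t'|)
      Filter.atTop (nhds (0 * |t - t'|)) :=
    (tendsto_tsum_compl_atTop_zero C).mul_const _
  have := le_of_tendsto_of_tendsto' hl hr key
  rw [zero_mul] at this
  exact sub_eq_zero.mp (abs_nonpos_iff.mp this)

/-- Symmetry swapping unconjugated and conjugated factors. -/
def symS : ℤ × ℤ × ℤ ≃ ℤ × ℤ × ℤ where
  toFun p := (p.2.1, p.1, p.1 - p.2.1 + p.2.2)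
  invFun p := (p.2.1, p.1, p.1 - p.2.1 + p.2.2)
  left_inv p := by ext <;> simp <;> ring
  right_inv p := by ext <;> simp <;> ring

/-- Symmetry swapping the two pairs. -/
def symT : ℤ × ℤ × ℤ ≃ ℤ × ℤ × ℤ where
  toFun p := (p.2.2, p.1 - p.2.1 + p.2.2, p.1)
  invFun p := (p.2.2, p.1 - p.2.1 + p.2.2, p.1)
  left_inv p := by ext <;> simp
  right_inv p := by ext <;> simp

/-- The imaginary part of the quartic expression. -/
def quartIm (u : ℤ → ℂ) (p : ℤ × ℤ × ℤ) : ℝ :=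
  (u p.1 * (starRingEnd ℂ) (u p.2.1) * u p.2.2 *
    (starRingEnd ℂ) (u (p.1 - p.2.1 + p.2.2))).im

lemma quartIm_symS (u : ℤ → ℂ) (p : ℤ × ℤ × ℤ) : quartIm u (symS p) = - quartIm u p := by
  obtain ⟨a, b, c⟩ := p
  have h : b - a + (a - b + c) = c := by ring
  simp only [quartIm, symS, Equiv.coe_fn_mk, h]
  rw [← Complex.conj_im]
  simp only [map_mul, Complex.conj_conj]
  congr 1
  ring

lemma quartIm_symT (u : ℤ → ℂ) (p : ℤ × ℤ × ℤ) : quartIm u (symT p) = quartIm u p := by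
  obtain ⟨a, b, c⟩ := p
  have h : c - (a - b + c) + a = b := by ring
  simp only [quartIm, symT, Equiv.coe_fn_mk, h]
  congr 1
  ring

lemma quart_momentum (u : ℤ → ℂ) :
    ∑' p : ℤ × ℤ × ℤ, ((p.1 - p.2.1 + p.2.2 : ℤ) : ℝ) * ((p.2.2 : ℝ) * quartIm u p) = 0 := by
  have h := symS.tsum_eq
    (fun p : ℤ × ℤ × ℤ => ((p.1 - p.2.1 + p.2.2 : ℤ) : ℝ) * ((p.2.2 : ℝ) * quartIm u p))
  simp only [quartIm_symS] at h
  have e : ∀ p : ℤ × ℤ × ℤ, (((symS p).1 - (symS p).2.1 + (symS p).2.2 : ℤ) : ℝ) *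
      (((symS p).2.2 : ℝ) * -quartIm u p) =
      -(((p.1 - p.2.1 + p.2.2 : ℤ) : ℝ) * ((p.2.2 : ℝ) * quartIm u p)) := by
    intro p
    simp only [symS, Equiv.coe_fn_mk]
    push_cast
    ring
  simp only [e, tsum_neg] at h
  linarith

lemma quart_mass (u : ℤ → ℂ)
    (hs : Summable fun p : ℤ × ℤ × ℤ => (p.2.2 : ℝ) * quartIm u p) :
    ∑' p : ℤ × ℤ × ℤ, (p.2.2 : ℝ) * quartIm u p = 0 := by
  have h1 := symS.tsum_eq (fun p : ℤ × ℤ × ℤ => (p.2.2 : ℝ) * quartIm u p)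
  have s1 := (symS.summable_iff (f := fun p : ℤ × ℤ × ℤ => (p.2.2 : ℝ) * quartIm u p)).mpr hs
  have a1 := hs.tsum_add s1
  have h2 := symT.tsum_eq (fun p : ℤ × ℤ × ℤ =>
    (p.2.2 : ℝ) * quartIm u p + ((symS p).2.2 : ℝ) * quartIm u (symS p))
  have e : ∀ p : ℤ × ℤ × ℤ, ((symT p).2.2 : ℝ) * quartIm u (symT p) +
      ((symS (symT p)).2.2 : ℝ) * quartIm u (symS (symT p)) =
      -((p.2.2 : ℝ) * quartIm u p + ((symS p).2.2 : ℝ) * quartIm u (symS p)) := by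
    intro p
    simp only [quartIm_symS, quartIm_symT]
    simp only [symS, symT, Equiv.coe_fn_mk]
    push_cast
    ring
  simp only [e, tsum_neg] at h2
  simp only [Function.comp_def] at a1
  linarith

/-- Summand of the cubic sum. -/
def cubTerm (u : ℤ → ℂ) (p : ℤ × ℤ × ℤ) : ℂ :=
  (p.2.2 : ℂ) * u p.1 * (starRingEnd ℂ) (u p.2.1) * u p.2.2

lemma cubTerm_bound {u : ℤ → ℂ} {B : ℝ} (hB : 0 < B)
    (hu : ∀ k : ℤ, max 1 |(k : ℝ)| * ‖u k‖ ≤ B * majG k) (p : ℤ × ℤ × ℤ) :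
    ‖cubTerm u p‖ ≤ B ^ 3 * (majG p.1 * (majG p.2.1 * majG p.2.2)) := by
  have h1 : ∀ k : ℤ, ‖u k‖ ≤ B * majG k := fun k =>
    (le_mul_of_one_le_left (norm_nonneg _) (le_max_left _ _)).trans (hu k)
  have h2 : ∀ k : ℤ, |(k : ℝ)| * ‖u k‖ ≤ B * majG k := fun k =>
    (mul_le_mul_of_nonneg_right (le_max_right _ _) (norm_nonneg _)).trans (hu k)
  have hg := fun k => (majG_pos k).le
  calc ‖cubTerm u p‖ = ‖u p.1‖ * (‖u p.2.1‖ * (|(p.2.2 : ℝ)| * ‖u p.2.2‖)) := by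
        simp only [cubTerm, norm_mul, RCLike.norm_conj, Complex.norm_intCast]
        ring
    _ ≤ (B * majG p.1) * ((B * majG p.2.1) * (B * majG p.2.2)) := by
        have := hg p.1
        have := hg p.2.1
        exact mul_le_mul (h1 _) (mul_le_mul (h1 _) (h2 _) (by positivity) (by positivity))
          (by positivity) (by positivity)
    _ = _ := by ring

/-- Main step: conservation of `∑ w_k |u_k|²` given the algebraic cancellation. -/
lemma conserved_of_cancel {α s B : ℝ} (hs : 3 ≤ s) (hB : 0 < B) {I : Set ℝ}
    (hI : I.OrdConnected) {u : ℝ → ℤ → ℂ} (hu : IsFourierSolution α I u)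
    (hbd : ∀ t ∈ I, HasSobNorm s (u t) ∧ sobNorm s (u t) ≤ B) (w : ℤ → ℝ)
    (hw : ∀ k : ℤ, |w k| ≤ max 1 |(k : ℝ)|)
    (hcancel : ∀ v : ℤ → ℂ,
      (Summable fun p : ℤ × ℤ × ℤ => w (p.1 - p.2.1 + p.2.2) * ((p.2.2 : ℝ) * quartIm v p)) →
      ∑' p : ℤ × ℤ × ℤ, w (p.1 - p.2.1 + p.2.2) * ((p.2.2 : ℝ) * quartIm v p) = 0) :
    (∀ t ∈ I, Summable fun k : ℤ => w k * ‖u t k‖ ^ 2) ∧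
    (∀ t ∈ I, ∀ t' ∈ I, (∑' k : ℤ, w k * ‖u t k‖ ^ 2) = ∑' k : ℤ, w k * ‖u t' k‖ ^ 2) := by
  have hdec : ∀ t ∈ I, ∀ k : ℤ, max 1 |(k : ℝ)| * ‖u t k‖ ≤ B * majG k := fun t ht k =>
    sob_decay hs hB (hbd t ht).1 (hbd t ht).2 k
  have hwu : ∀ t ∈ I, ∀ k : ℤ, |w k| * ‖u t k‖ ≤ B * majG k := fun t ht k =>
    (mul_le_mul_of_nonneg_right (hw k) (norm_nonneg _)).trans (hdec t ht k)
  have hu1 : ∀ t ∈ I, ∀ k : ℤ, ‖u t k‖ ≤ B := fun t ht k =>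
    ((le_mul_of_one_le_left (norm_nonneg _) (le_max_left _ _)).trans (hdec t ht k)).trans
      (mul_le_of_le_one_right hB.le (majG_le_one k))
  have hsum : ∀ t ∈ I, Summable fun k : ℤ => w k * ‖u t k‖ ^ 2 := by
    intro t ht
    refine ((majG_summable.mul_left B).mul_right B).of_norm_bounded (fun k => ?_)
    rw [norm_mul, Real.norm_eq_abs, norm_pow, norm_norm, pow_two, ← mul_assoc]
    exact mul_le_mul (hwu t ht k) (hu1 t ht k) (norm_nonneg _)
      (mul_nonneg hB.le (majG_pos k).le)
  refine ⟨hsum, fun t ht t' ht' => ?_⟩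
  set S : ℝ := ∑' p : ℤ × ℤ × ℤ, B ^ 3 * (majG p.1 * (majG p.2.1 * majG p.2.2)) with hS
  have hSs := majG3_summable.mul_left (B ^ 3)
  have hpos : ∀ p : ℤ × ℤ × ℤ, 0 ≤ B ^ 3 * (majG p.1 * (majG p.2.1 * majG p.2.2)) := fun p => by
    have := majG_pos p.1
    have := majG_pos p.2.1
    have := majG_pos p.2.2
    positivity
  have hcub : ∀ t ∈ I, ∀ k : ℤ, ‖cubicSum (u t) k‖ ≤ S := by
    intro t ht k
    refine (tsum_of_norm_bounded (hSs.subtype {p | p.1 - p.2.1 + p.2.2 = k}).hasSum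
      (fun p => cubTerm_bound hB (hdec t ht) p.1)).trans ?_
    exact hSs.tsum_subtype_le _ _ hpos
  refine tsum_const_of_deriv hI (fun k τ => w k * ‖u τ k‖ ^ 2)
    (fun k τ => w k * (-2 * ((starRingEnd ℂ) (u τ k) * cubicSum (u τ) k).im))
    (fun k => 2 * (B * majG k * S)) ?_ ?_ ?_ hsum ?_ ht ht'
  · exact (((majG_summable.mul_left B).mul_right S).mul_left 2)
  · intro k τ hτ
    have h := ((hu k τ hτ).2.norm_sq).const_mul (w k)
    refine h.congr_deriv ?_
    rw [Complex.inner]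
    simp only [Complex.mul_re, Complex.mul_im, Complex.add_re, Complex.add_im, Complex.neg_re,
      Complex.neg_im, Complex.I_re, Complex.I_im, Complex.ofReal_re, Complex.ofReal_im,
      Complex.conj_re, Complex.conj_im]
    ring
  · intro k τ hτ
    rw [abs_mul, abs_mul]
    have h1 := Complex.abs_im_le_norm ((starRingEnd ℂ) (u τ k) * cubicSum (u τ) k)
    rw [norm_mul, RCLike.norm_conj] at h1
    calc |w k| * (|(-2 : ℝ)| * |((starRingEnd ℂ) (u τ k) * cubicSum (u τ) k).im|)
        ≤ |w k| * (|(-2 : ℝ)| * (‖u τ k‖ * ‖cubicSum (u τ) k‖)) := by gcongr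
      _ = 2 * ((|w k| * ‖u τ k‖) * ‖cubicSum (u τ) k‖) := by
          rw [abs_neg, abs_two]; ring
      _ ≤ 2 * (B * majG k * S) := by
          have := mul_le_mul (hwu τ hτ k) (hcub τ hτ k) (norm_nonneg _)
            (mul_nonneg hB.le (majG_pos k).le)
          linarith
  · intro τ hτ
    let G : ℤ × ℤ × ℤ → ℝ := fun p => w (p.1 - p.2.1 + p.2.2) * ((p.2.2 : ℝ) * quartIm (u τ) p)
    have hGim : ∀ p : ℤ × ℤ × ℤ, (p.2.2 : ℝ) * quartIm (u τ) p =
        ((starRingEnd ℂ) (u τ (p.1 - p.2.1 + p.2.2)) * cubTerm (u τ) p).im := by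
      intro p
      rw [quartIm, ← Complex.im_ofReal_mul]
      congr 1
      rw [cubTerm]
      push_cast
      ring
    have hGs : Summable G := by
      refine (hSs.mul_left B).of_norm_bounded (fun p => ?_)
      simp only [G, hGim]
      rw [norm_mul, Real.norm_eq_abs, Real.norm_eq_abs]
      have h1 := Complex.abs_im_le_norm
        ((starRingEnd ℂ) (u τ (p.1 - p.2.1 + p.2.2)) * cubTerm (u τ) p)
      rw [norm_mul, RCLike.norm_conj] at h1
      refine (mul_le_mul_of_nonneg_left h1 (abs_nonneg _)).trans ?_
      rw [← mul_assoc]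
      exact mul_le_mul ((hwu τ hτ _).trans (mul_le_of_le_one_right hB.le (majG_le_one _)))
        (cubTerm_bound hB (hdec τ hτ) p) (norm_nonneg _) hB.le
    have hG0 : ∑' p, G p = 0 := hcancel (u τ) hGs
    have hfib := hGs.hasSum.tsum_fiberwise (fun p : ℤ × ℤ × ℤ => p.1 - p.2.1 + p.2.2)
    rw [hG0] at hfib
    have hk : ∀ k : ℤ, w k * (-2 * ((starRingEnd ℂ) (u τ k) * cubicSum (u τ) k).im) =
        -2 * ∑' p : ((fun p : ℤ × ℤ × ℤ => p.1 - p.2.1 + p.2.2) ⁻¹' {k}), G p := by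
      intro k
      have hcs : Summable fun p : ((fun p : ℤ × ℤ × ℤ => p.1 - p.2.1 + p.2.2) ⁻¹' {k}) =>
          cubTerm (u τ) p :=
        (hSs.of_norm_bounded (cubTerm_bound hB (hdec τ hτ))).subtype _
      have e1 : cubicSum (u τ) k =
          ∑' p : ((fun p : ℤ × ℤ × ℤ => p.1 - p.2.1 + p.2.2) ⁻¹' {k}), cubTerm (u τ) p := rfl
      rw [e1, ← hcs.tsum_mul_left, Complex.im_tsum (hcs.mul_left _), mul_left_comm,
        ← tsum_mul_left]
      congr 1
      refine tsum_congr fun p => ?_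
      have hp : p.1.1 - p.1.2.1 + p.1.2.2 = k := p.2
      simp only [G, hGim, hp]
    have := (hfib.mul_left (-2)).tsum_eq
    rw [mul_zero] at this
    rw [← this]
    exact tsum_congr hk

/-- Conservation of mass and momentum for Fourier solutions of
`∂ₜ u = -i|D|^α u + |u|² u_x` with bounded `H^s` norm, `s ≥ 3`. -/
theorem mass_momentum_conserved (α s B : ℝ) (hα₀ : 0 < α) (hα₁ : α < 1)
    (hs : 3 ≤ s) (hB : 0 < B) (I : Set ℝ) (hI : I.OrdConnected)
    (u : ℝ → ℤ → ℂ) (hu : IsFourierSolution α I u)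
    (hbd : ∀ t ∈ I, HasSobNorm s (u t) ∧ sobNorm s (u t) ≤ B) :
    (∀ t ∈ I, Summable fun k : ℤ => ‖u t k‖ ^ 2) ∧
    (∀ t ∈ I, Summable fun k : ℤ => (k : ℝ) * ‖u t k‖ ^ 2) ∧
    (∀ t ∈ I, ∀ t' ∈ I, (∑' k : ℤ, ‖u t k‖ ^ 2) = ∑' k : ℤ, ‖u t' k‖ ^ 2) ∧
    (∀ t ∈ I, ∀ t' ∈ I,
      (∑' k : ℤ, (k : ℝ) * ‖u t k‖ ^ 2) = ∑' k : ℤ, (k : ℝ) * ‖u t' k‖ ^ 2) := by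
  have h1 := conserved_of_cancel hs hB hI hu hbd (fun _ => 1) (fun k => by simp) (by
    intro v hv
    simp only [one_mul] at hv ⊢
    exact quart_mass v hv)
  have h2 := conserved_of_cancel hs hB hI hu hbd (fun k => (k : ℝ)) (fun k => le_max_right _ _)
    (fun v _ => quart_momentum v)
  simp only [one_mul] at h1
  exact ⟨h1.1, h2.1, h1.2, h2.2⟩

end
end

section
/- Let α ∈ (0,1), s ≥ 3, B > 0, I ⊆ ℝ an interval containing 0, and let u : I → (ℤ → ℂ) be a Fourier solution of ∂_t u = −i|D|^α u + |u|²u_x on the torus with sup_{t∈I} ‖u(t)‖_s ≤ B. Set M := ∑_{k∈ℤ} |u_k(0)|², P := −∑_{k∈ℤ} k|u_k(0)|², and define v_k(t) := e^{itP} e^{−ikMt} u_k(t). Then |v_k(t)| = |u_k(t)| for all k and t, and v solves the renormalized equation: for every k ∈ ℤ the map t ↦ v_k(t) is differentiable on I with v_k'(t) = −i|k|^α v_k(t) + i ∑_{(k₁,k₂,k₃)∈ℤ³, k₁−k₂+k₃=k} k₃ v_{k₁}(t) \overline{v_{k₂}(t)} v_{k₃}(t) − i k M v_k(t) + i P v_k(t),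 the series converging absolutely. -/
noncomputable section

/-- The gauge/Galilean renormalized variable `v_k(t) = e^{itP} e^{-ikMt} u_k(t)`
has the same moduli as `u` and solves the renormalized equation
`∂ₜ v = -i|D|^α v + |v|² v_x - M v_x + i P v`. -/
theorem renormalized_equation (α s B : ℝ) (hα₀ : 0 < α) (hα₁ : α < 1)
    (hs : 3 ≤ s) (hB : 0 < B) (I : Set ℝ) (hI : I.OrdConnected) (h0I : (0 : ℝ) ∈ I)
    (u : ℝ → ℤ → ℂ) (hu : IsFourierSolution α I u)
    (hbd : ∀ t ∈ I, HasSobNorm s (u t) ∧ sobNorm s (u t) ≤ B)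
    (M P : ℝ)
    (hM : M = ∑' k : ℤ, ‖u 0 k‖ ^ 2)
    (hP : P = -∑' k : ℤ, (k : ℝ) * ‖u 0 k‖ ^ 2)
    (v : ℝ → ℤ → ℂ)
    (hv : ∀ t : ℝ, ∀ k : ℤ, v t k =
      Complex.exp (Complex.I * (t : ℂ) * (P : ℂ)) *
        Complex.exp (-Complex.I * (k : ℂ) * (M : ℂ) * (t : ℂ)) * u t k) :
    (∀ t : ℝ, ∀ k : ℤ, ‖v t k‖ = ‖u t k‖) ∧
    ∀ k : ℤ, ∀ t ∈ I,
      CubicSummable (v t) k ∧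
      HasDerivWithinAt (fun τ => v τ k)
        (-Complex.I * Complex.ofReal (|(k : ℝ)| ^ α) * v t k +
          Complex.I * cubicSum (v t) k -
          Complex.I * (k : ℂ) * (M : ℂ) * v t k +
          Complex.I * (P : ℂ) * v t k) I t := by
  have hph : ∀ t : ℝ, ∀ k : ℤ, v t k =
      Complex.exp (((t * P - k * M * t : ℝ) : ℂ) * Complex.I) * u t k := by
    intro t k
    rw [hv, ← Complex.exp_add]
    congr 2
    push_cast
    ring
  have hnorm : ∀ t : ℝ, ∀ k : ℤ, ‖v t k‖ = ‖u t k‖ := by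
    intro t k
    rw [hph, norm_mul, Complex.norm_exp_ofReal_mul_I, one_mul]
  refine ⟨hnorm, fun k t ht => ?_⟩
  obtain ⟨hsum, hder⟩ := hu k t ht
  refine ⟨?_, ?_⟩
  · unfold CubicSummable at hsum ⊢
    simpa only [hnorm] using hsum
  · have hcub : cubicSum (v t) k =
        Complex.exp (((t * P - k * M * t : ℝ) : ℂ) * Complex.I) * cubicSum (u t) k := by
      unfold cubicSum
      rw [← tsum_mul_left]
      refine tsum_congr ?_
      rintro ⟨⟨a, b, c⟩, hp⟩
      simp only at hp ⊢
      have hE : Complex.exp (((t * P - k * M * t : ℝ) : ℂ) * Complex.I) =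
          Complex.exp (((t * P - a * M * t : ℝ) : ℂ) * Complex.I) *
          (starRingEnd ℂ) (Complex.exp (((t * P - b * M * t : ℝ) : ℂ) * Complex.I)) *
          Complex.exp (((t * P - c * M * t : ℝ) : ℂ) * Complex.I) := by
        rw [← Complex.exp_conj, ← Complex.exp_add, ← Complex.exp_add, map_mul,
          Complex.conj_ofReal, Complex.conj_I, ← hp]
        congr 1
        push_cast
        ring
      rw [hph t a, hph t b, hph t c, hE, map_mul]
      ring
    have h1 : HasDerivAt (fun τ : ℝ => ((τ * P - k * M * τ : ℝ) : ℂ) * Complex.I)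
        (((P - k * M : ℝ) : ℂ) * Complex.I) t := by
      have h2 : HasDerivAt (fun τ : ℝ => τ * P - k * M * τ) (P - k * M) t := by
        have h4 := ((hasDerivAt_id t).mul_const P).sub ((hasDerivAt_id t).const_mul (k * M))
        rw [one_mul, mul_one] at h4
        exact h4
      exact h2.ofReal_comp.mul_const _
    have h3 := h1.cexp.hasDerivWithinAt (s := I) |>.mul hder
    have hfun : (fun τ => v τ k) = (fun τ : ℝ =>
        Complex.exp (((τ * P - k * M * τ : ℝ) : ℂ) * Complex.I)) * (fun τ => u τ k) := by
      funext τ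
      exact hph τ k
    rw [hfun]
    refine h3.congr_deriv ?_
    rw [hcub, hph t k]
    push_cast
    ring

end
end

section
/- Let α ∈ (0,1). Then: (a) 𝔕^{(1)}_Λ = ∅, i.e. no (j⃗,σ⃗) ∈ 𝔓₄ with exactly one index outside Λ = {−1,1} satisfies Ω_α(j⃗,σ⃗) = 0; (b) the set 𝔓^{(1)}_Λ is finite; (c) there exists c > 0 such that |Ω_α(j⃗,σ⃗)| ≥ c for every (j⃗,σ⃗) ∈ 𝔓^{(1)}_Λ. -/
noncomputable section

/-- The signs are admissible: each `σ i` is `±1`. -/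
def sigmaOK (σ : Fin 4 → ℤ) : Prop := ∀ i, σ i = 1 ∨ σ i = -1

/-- Membership in `𝔓₄`: signs are `±1`, momentum `∑ σᵢ jᵢ = 0`, gauge `∑ σᵢ = 0`. -/
def inP4 (j σ : Fin 4 → ℤ) : Prop :=
  sigmaOK σ ∧ (∑ i, σ i * j i) = 0 ∧ (∑ i, σ i) = 0

/-- The 4-wave resonance function `Ω_α(j⃗,σ⃗) = ∑ σᵢ |jᵢ|^α`. -/
def OmegaRes (α : ℝ) (j σ : Fin 4 → ℤ) : ℝ :=
  ∑ i, (σ i : ℝ) * |(j i : ℝ)| ^ α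

/-- Number of the indices `j₁,…,j₄` lying outside `Λ = {-1,1}`. -/
def outsideCount (j : Fin 4 → ℤ) : ℕ :=
  (Finset.univ.filter fun i => j i ≠ -1 ∧ j i ≠ 1).card

/-- The base index tuple `(k,k,ℓ,ℓ)`. -/
def jBase (k ℓ : ℤ) : Fin 4 → ℤ := ![k, k, ℓ, ℓ]

/-- The base sign tuple `(+,-,+,-)`. -/
def sigmaBase : Fin 4 → ℤ := ![1, -1, 1, -1]

/-- Exactly one index lies outside `Λ`, and it has absolute value `3`. -/
lemma P1_structure (j σ : Fin 4 → ℤ) (h : inP4 j σ) (hc : outsideCount j = 1) :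
    ∃ a, (j a = 3 ∨ j a = -3) ∧ ∀ i, i ≠ a → (j i = 1 ∨ j i = -1) := by
  obtain ⟨hσ, hm, hg⟩ := h
  obtain ⟨a, ha⟩ := Finset.card_eq_one.mp hc
  have key : ∀ i, (j i ≠ -1 ∧ j i ≠ 1) ↔ i = a := by
    intro i
    have := congrArg (fun s => i ∈ s) ha
    simpa using this
  have hout : ∀ i, i ≠ a → (j i = 1 ∨ j i = -1) := by
    intro i hi
    have := mt (key i).1 hi
    tauto
  refine ⟨a, ?_, hout⟩
  have haa := (key a).2 rfl
  have hterm : ∀ i, i ≠ a → (σ i * j i = 1 ∨ σ i * j i = -1) := by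
    intro i hi
    rcases hσ i with h1 | h1 <;> rcases hout i hi with h2 | h2 <;> simp [h1, h2]
  have hta : σ a * j a = j a ∨ σ a * j a = - j a := by
    rcases hσ a with h1 | h1 <;> simp [h1]
  have t0 := hterm 0
  have t1 := hterm 1
  have t2 := hterm 2
  have t3 := hterm 3
  rw [Fin.sum_univ_four] at hm
  clear key ha hout hterm hc hg hσ
  fin_cases a <;> simp at t0 t1 t2 t3 hta haa ⊢ <;> omega

/-- On `𝔓¹_Λ` the resonance function is `±(3^α - 1)`. -/
lemma P1_abs_Omega (α : ℝ) (hα : 0 < α) (j σ : Fin 4 → ℤ) (h : inP4 j σ)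
    (hc : outsideCount j = 1) : |OmegaRes α j σ| = 3 ^ α - 1 := by
  obtain ⟨a, ha, ho⟩ := P1_structure j σ h hc
  obtain ⟨hσ, -, hg⟩ := h
  have hg' : ∑ i, (σ i : ℝ) = 0 := by exact_mod_cast hg
  have hpos : (0 : ℝ) < 3 ^ α - 1 := sub_pos.2 (Real.one_lt_rpow (by norm_num) hα)
  have e : OmegaRes α j σ = (σ a : ℝ) * (3 ^ α - 1) := by
    have : OmegaRes α j σ = ∑ i, (σ i : ℝ) * (|(j i : ℝ)| ^ α - 1) := by
      simp only [mul_sub, Finset.sum_sub_distrib, mul_one, hg', sub_zero, OmegaRes]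
    rw [this, Finset.sum_eq_single a]
    · rcases ha with ha | ha <;> simp [ha]
    · intro i _ hi
      rcases ho i hi with h1 | h1 <;> simp [h1]
    · simp
  rw [e, abs_mul, abs_of_pos hpos]
  rcases hσ a with h1 | h1 <;> simp [h1]

/-- There are no 4-wave resonances with exactly one index outside `Λ = {-1,1}`;
the set `𝔓¹_Λ` is finite and on it `|Ω_α|` is bounded below by a positive constant. -/
theorem P1_no_resonances (α : ℝ) (hα₀ : 0 < α) (hα₁ : α < 1) :
    (∀ j σ : Fin 4 → ℤ, inP4 j σ → outsideCount j = 1 → OmegaRes α j σ ≠ 0) ∧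
    (Set.Finite {p : (Fin 4 → ℤ) × (Fin 4 → ℤ) | inP4 p.1 p.2 ∧ outsideCount p.1 = 1}) ∧
    (∃ c : ℝ, 0 < c ∧ ∀ j σ : Fin 4 → ℤ, inP4 j σ → outsideCount j = 1 →
      c ≤ |OmegaRes α j σ|) := by
  have hpos : (0 : ℝ) < 3 ^ α - 1 := sub_pos.2 (Real.one_lt_rpow (by norm_num) hα₀)
  refine ⟨?_, ?_, 3 ^ α - 1, hpos, fun j σ h hc => (P1_abs_Omega α hα₀ j σ h hc).ge⟩
  · intro j σ h hc h0
    have := P1_abs_Omega α hα₀ j σ h hc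
    rw [h0, abs_zero] at this
    linarith
  · refine ((Set.finite_Icc (fun _ => -3) (fun _ => 3)).prod
      (Set.finite_Icc (fun _ => -1) (fun _ => 1))).subset ?_
    rintro ⟨j, σ⟩ ⟨h, hc⟩
    obtain ⟨a, ha, ho⟩ := P1_structure j σ h hc
    have hj : ∀ i, -3 ≤ j i ∧ j i ≤ 3 := by
      intro i
      by_cases hi : i = a
      · subst hi
        omega
      · have := ho i hi
        omega
    have hs : ∀ i, -1 ≤ σ i ∧ σ i ≤ 1 := by
      intro i
      have := h.1 i
      dsimp only at this
      omega
    exact ⟨⟨fun i => (hj i).1, fun i => (hj i).2⟩, ⟨fun i => (hs i).1, fun i => (hs i).2⟩⟩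
end
end

section
/- Let α ∈ (0,1). Then: (a) 𝔕^{(2)}_Λ consists exactly of the tuples obtained from ((k,k,ℓ,ℓ),(1,−1,1,−1)) with k ∈ Λ = {−1,1} and ℓ ∈ ℤ∖Λ by a simultaneous permutation of the four index–sign pairs; (b) there exists c > 0 such that |Ω_α(j⃗,σ⃗)| ≥ c / max(|j₁|,|j₂|,|j₃|,|j₄|)^{1−α} for every (j⃗,σ⃗) ∈ 𝔓^{(2)}_Λ ∖ 𝔕^{(2)}_Λ. -/
noncomputable section

theorem boolSort : ∀ p s : Fin 4 → Bool,
    (Finset.univ.filter fun i => p i = true).card = 2 →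
    (Finset.univ.filter fun i => s i = true).card = 2 →
    ∃ π : Equiv.Perm (Fin 4), p (π 0) = false ∧ p (π 1) = false ∧ p (π 2) = true ∧ p (π 3) = true ∧
      ((s (π 0) = true ∧ s (π 1) = false ∧ s (π 2) = true ∧ s (π 3) = false) ∨
       (s (π 0) = true ∧ s (π 1) = true ∧ s (π 2) = false ∧ s (π 3) = false) ∨
       (s (π 0) = false ∧ s (π 1) = false ∧ s (π 2) = true ∧ s (π 3) = true)) := by
  decide +kernel

theorem sortLemma (j σ : Fin 4 → ℤ) (h : inP4 j σ) (hc : outsideCount j = 2) :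
    ∃ π : Equiv.Perm (Fin 4), (j (π 0) = -1 ∨ j (π 0) = 1) ∧ (j (π 1) = -1 ∨ j (π 1) = 1) ∧
      (j (π 2) ≠ -1 ∧ j (π 2) ≠ 1) ∧ (j (π 3) ≠ -1 ∧ j (π 3) ≠ 1) ∧
      ((σ (π 0) = 1 ∧ σ (π 1) = -1 ∧ σ (π 2) = 1 ∧ σ (π 3) = -1) ∨
       (σ (π 0) = 1 ∧ σ (π 1) = 1 ∧ σ (π 2) = -1 ∧ σ (π 3) = -1) ∨
       (σ (π 0) = -1 ∧ σ (π 1) = -1 ∧ σ (π 2) = 1 ∧ σ (π 3) = 1)) := by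
  obtain ⟨hs, -, hg⟩ := h
  have hneg : ∀ i, σ i ≠ 1 → σ i = -1 := fun i hi => (hs i).resolve_left hi
  have hcard : (Finset.univ.filter fun i => σ i = 1).card = 2 := by
    have e : ∀ i, σ i = 2 * (if σ i = 1 then 1 else 0) - 1 := by
      intro i
      rcases hs i with h | h <;> simp [h]
    rw [Finset.sum_congr rfl (fun i _ => e i), Finset.sum_sub_distrib, ← Finset.mul_sum,
      Finset.sum_boole] at hg
    simp at hg
    omega
  obtain ⟨π, h0, h1, h2, h3, h4⟩ := boolSort (fun i => decide (j i ≠ -1 ∧ j i ≠ 1))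
    (fun i => decide (σ i = 1)) (by simpa [outsideCount] using hc) (by simpa using hcard)
  simp only [decide_eq_true_eq, decide_eq_false_iff_not] at h0 h1 h2 h3 h4
  refine ⟨π, by tauto, by tauto, h2, h3, ?_⟩
  rcases h4 with ⟨a, b, c, d⟩ | ⟨a, b, c, d⟩ | ⟨a, b, c, d⟩
  · exact Or.inl ⟨a, hneg _ b, c, hneg _ d⟩
  · exact Or.inr (Or.inl ⟨a, b, hneg _ c, hneg _ d⟩)
  · exact Or.inr (Or.inr ⟨hneg _ a, hneg _ b, c, d⟩)

/-- Quantitative strict monotonicity of `x ^ α` on steps of length two. -/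
theorem stepBound (α : ℝ) (hα₀ : 0 < α) (hα₁ : α < 1) (x M : ℝ) (hx : 0 ≤ x) (hM : x + 2 ≤ M) :
    2 * α / M ^ (1 - α) ≤ (x + 2) ^ α - x ^ α := by
  have hy : 0 < x + 2 := by linarith
  have hb : (x / (x + 2)) ^ α ≤ 1 + α * (x / (x + 2) - 1) := by
    have h := rpow_one_add_le_one_add_mul_self (s := x / (x + 2) - 1)
      (by have : 0 ≤ x / (x + 2) := by positivity
          linarith) hα₀.le hα₁.le
    simpa using h
  rw [Real.div_rpow hx hy.le, div_le_iff₀ (by positivity)] at hb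
  have e1 : (1 + α * (x / (x + 2) - 1)) * (x + 2) ^ α
      = (x + 2) ^ α - 2 * α * ((x + 2) ^ α / (x + 2)) := by
    field_simp
    ring
  have e2 : (x + 2) ^ α / (x + 2) = 1 / (x + 2) ^ (1 - α) := by
    rw [Real.rpow_sub hy, Real.rpow_one]
    field_simp
  have h3 : 2 * α / M ^ (1 - α) ≤ 2 * α / (x + 2) ^ (1 - α) := by
    have : (x + 2) ^ (1 - α) ≤ M ^ (1 - α) := Real.rpow_le_rpow hy.le hM (by linarith)
    gcongr
  rw [e1, e2] at hb
  have : 2 * α * (1 / (x + 2) ^ (1 - α)) = 2 * α / (x + 2) ^ (1 - α) := by ring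
  linarith

theorem sameBound (α : ℝ) (hα₀ : 0 < α) (hα₁ : α < 1) (a b : ℤ)
    (ha : a ≠ -1 ∧ a ≠ 1) (hb : b ≠ -1 ∧ b ≠ 1) (h : a + b = 2 ∨ a + b = 0 ∨ a + b = -2) :
    min (2 - (2:ℝ) ^ α) (2 * (2:ℝ) ^ α - 2) ≤ |2 - |(a:ℝ)| ^ α - |(b:ℝ)| ^ α| := by
  have h2 : (0:ℝ) < 2 ^ α := by positivity
  have key : (|a| = 0 ∧ |b| = 0) ∨ (|a| = 0 ∧ |b| = 2) ∨ (|a| = 2 ∧ |b| = 0) ∨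
      (2 ≤ |a| ∧ 2 ≤ |b|) := by
    rcases abs_cases a with h₁ | h₁ <;> rcases abs_cases b with h₂ | h₂ <;> omega
  have c1 : ∀ z : ℤ, |z| = 0 → |(z:ℝ)| = 0 := fun z hz => by exact_mod_cast hz
  have c2 : ∀ z : ℤ, |z| = 2 → |(z:ℝ)| = 2 := fun z hz => by exact_mod_cast hz
  have c3 : ∀ z : ℤ, 2 ≤ |z| → (2:ℝ) ^ α ≤ |(z:ℝ)| ^ α := fun z hz =>
    Real.rpow_le_rpow (by norm_num) (by exact_mod_cast hz) hα₀.le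
  rcases key with ⟨h, h'⟩ | ⟨h, h'⟩ | ⟨h, h'⟩ | ⟨h, h'⟩
  · rw [c1 _ h, c1 _ h', Real.zero_rpow hα₀.ne']
    refine (min_le_left _ _).trans (le_trans ?_ (le_abs_self _))
    linarith
  · rw [c1 _ h, c2 _ h', Real.zero_rpow hα₀.ne']
    refine (min_le_left _ _).trans (le_trans ?_ (le_abs_self _))
    linarith
  · rw [c2 _ h, c1 _ h', Real.zero_rpow hα₀.ne']
    refine (min_le_left _ _).trans (le_trans ?_ (le_abs_self _))
    linarith
  · refine (min_le_right _ _).trans (le_trans ?_ (neg_le_abs _))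
    linarith [c3 _ h, c3 _ h']

theorem oppBound (α : ℝ) (hα₀ : 0 < α) (hα₁ : α < 1) (a b : ℤ) (M : ℝ)
    (ha : a ≠ -1 ∧ a ≠ 1) (hb : b ≠ -1 ∧ b ≠ 1) (h : a - b = 2 ∨ a - b = -2)
    (hMa : |(a:ℝ)| ≤ M) (hMb : |(b:ℝ)| ≤ M) :
    2 * α / M ^ (1 - α) ≤ |(|(a:ℝ)| ^ α - |(b:ℝ)| ^ α)| := by
  have key : |a| = |b| + 2 ∨ |b| = |a| + 2 := by
    rcases abs_cases a with h₁ | h₁ <;> rcases abs_cases b with h₂ | h₂ <;> omega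
  rcases key with h | h
  · have h' : |(a:ℝ)| = |(b:ℝ)| + 2 := by exact_mod_cast h
    rw [h'] at hMa ⊢
    exact (stepBound α hα₀ hα₁ _ M (abs_nonneg _) hMa).trans (le_abs_self _)
  · have h' : |(b:ℝ)| = |(a:ℝ)| + 2 := by exact_mod_cast h
    rw [h'] at hMb ⊢
    rw [abs_sub_comm]
    exact (stepBound α hα₀ hα₁ _ M (abs_nonneg _) hMb).trans (le_abs_self _)

/-- The constant of the lower bound. -/
def cRes (α : ℝ) : ℝ := min (min (2 - (2:ℝ) ^ α) (2 * (2:ℝ) ^ α - 2)) (2 * α)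

theorem cRes_pos (α : ℝ) (hα₀ : 0 < α) (hα₁ : α < 1) : 0 < cRes α := by
  have h1 : (2:ℝ) ^ α < 2 := by
    simpa using Real.rpow_lt_rpow_of_exponent_lt (x := 2) (by norm_num) hα₁
  have h2 : 1 < (2:ℝ) ^ α := Real.one_lt_rpow (by norm_num) hα₀
  refine lt_min (lt_min ?_ ?_) ?_ <;> linarith

theorem dichotomy (α : ℝ) (hα₀ : 0 < α) (hα₁ : α < 1) (j σ : Fin 4 → ℤ)
    (h : inP4 j σ) (hc : outsideCount j = 2) :
    (∃ π : Equiv.Perm (Fin 4), ∃ k ℓ : ℤ,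
          (k = -1 ∨ k = 1) ∧ (ℓ ≠ -1 ∧ ℓ ≠ 1) ∧
          j = (fun i => jBase k ℓ (π i)) ∧ σ = (fun i => sigmaBase (π i))) ∨
    (0 < cRes α / ((Finset.univ.sup fun i => (j i).natAbs : ℕ) : ℝ) ^ (1 - α) ∧
      cRes α / ((Finset.univ.sup fun i => (j i).natAbs : ℕ) : ℝ) ^ (1 - α) ≤
          |OmegaRes α j σ|) := by
  obtain ⟨π, h0, h1, h2, h3, h4⟩ := sortLemma j σ h hc
  set M : ℝ := ((Finset.univ.sup fun i => (j i).natAbs : ℕ) : ℝ) with hM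
  have hle : ∀ i, |(j i : ℝ)| ≤ M := by
    intro i
    have : (j i).natAbs ≤ Finset.univ.sup fun i => (j i).natAbs :=
      Finset.le_sup (f := fun i => (j i).natAbs) (Finset.mem_univ i)
    rw [← Int.cast_abs, Int.abs_eq_natAbs, Int.cast_natCast, hM]
    exact_mod_cast this
  have a0 : |(j (π 0) : ℝ)| = 1 := by rcases h0 with h | h <;> simp [h]
  have a1 : |(j (π 1) : ℝ)| = 1 := by rcases h1 with h | h <;> simp [h]
  have hM1 : 1 ≤ M := a0 ▸ hle (π 0)
  have hMp : 1 ≤ M ^ (1 - α) := Real.one_le_rpow hM1 (by linarith)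
  have hcp := cRes_pos α hα₀ hα₁
  have hpos : 0 < cRes α / M ^ (1 - α) := by positivity
  have hmom : ∑ i, σ (π i) * j (π i) = 0 := by
    rw [Equiv.sum_comp π (fun i => σ i * j i)]
    exact h.2.1
  have hΩ : OmegaRes α j σ = ∑ i, (σ (π i) : ℝ) * |(j (π i) : ℝ)| ^ α :=
    (Equiv.sum_comp π (fun i => (σ i : ℝ) * |(j i : ℝ)| ^ α)).symm
  rw [Fin.sum_univ_four] at hmom hΩ
  rw [a0, a1, Real.one_rpow] at hΩ
  have cs : cRes α / M ^ (1 - α) ≤ min (2 - (2:ℝ) ^ α) (2 * (2:ℝ) ^ α - 2) :=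
    (div_le_self hcp.le hMp).trans (min_le_left _ _)
  rcases h4 with ⟨s0, s1, s2, s3⟩ | ⟨s0, s1, s2, s3⟩ | ⟨s0, s1, s2, s3⟩
  · rw [s0, s1, s2, s3] at hmom hΩ
    by_cases hk : j (π 0) = j (π 1)
    · left
      have hl : j (π 2) = j (π 3) := by omega
      refine ⟨π.symm, j (π 0), j (π 2), h0, h2, ?_, ?_⟩
      · funext i
        obtain ⟨m, rfl⟩ := π.surjective i
        rw [Equiv.symm_apply_apply]
        fin_cases m <;> simp [jBase, hk, hl]
      · funext i
        obtain ⟨m, rfl⟩ := π.surjective i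
        rw [Equiv.symm_apply_apply]
        fin_cases m <;> simp [sigmaBase, s0, s1, s2, s3]
    · right
      refine ⟨hpos, ?_⟩
      have hab : j (π 2) - j (π 3) = 2 ∨ j (π 2) - j (π 3) = -2 := by omega
      have := oppBound α hα₀ hα₁ _ _ M h2 h3 hab (hle _) (hle _)
      have e : OmegaRes α j σ = |(j (π 2) : ℝ)| ^ α - |(j (π 3) : ℝ)| ^ α := by
        rw [hΩ]; push_cast; ring
      rw [e]
      refine le_trans ?_ this
      have : cRes α ≤ 2 * α := min_le_right _ _
      gcongr
  · right
    refine ⟨hpos, cs.trans ?_⟩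
    rw [s0, s1, s2, s3] at hmom hΩ
    have := sameBound α hα₀ hα₁ _ _ h2 h3 (by omega)
    have e : OmegaRes α j σ = 2 - |(j (π 2) : ℝ)| ^ α - |(j (π 3) : ℝ)| ^ α := by
      rw [hΩ]; push_cast; ring
    rwa [e]
  · right
    refine ⟨hpos, cs.trans ?_⟩
    rw [s0, s1, s2, s3] at hmom hΩ
    have := sameBound α hα₀ hα₁ _ _ h2 h3 (by omega)
    have e : OmegaRes α j σ = -(2 - |(j (π 2) : ℝ)| ^ α - |(j (π 3) : ℝ)| ^ α) := by
      rw [hΩ]; push_cast; ring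
    rwa [e, abs_neg]

theorem resonant_of_base (α : ℝ) (π : Equiv.Perm (Fin 4)) (k ℓ : ℤ)
    (hk : k = -1 ∨ k = 1) (hl : ℓ ≠ -1 ∧ ℓ ≠ 1) :
    inP4 (fun i => jBase k ℓ (π i)) (fun i => sigmaBase (π i)) ∧
    outsideCount (fun i => jBase k ℓ (π i)) = 2 ∧
    OmegaRes α (fun i => jBase k ℓ (π i)) (fun i => sigmaBase (π i)) = 0 := by
  refine ⟨⟨?_, ?_, ?_⟩, ?_, ?_⟩
  · intro i
    show sigmaBase (π i) = 1 ∨ sigmaBase (π i) = -1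
    generalize π i = m
    fin_cases m <;> simp [sigmaBase]
  · rw [Equiv.sum_comp π (fun i => sigmaBase i * jBase k ℓ i), Fin.sum_univ_four]
    simp [sigmaBase, jBase]
  · rw [Equiv.sum_comp π (fun i => sigmaBase i), Fin.sum_univ_four]
    simp [sigmaBase]
  · unfold outsideCount
    rw [Finset.card_filter,
      Equiv.sum_comp π (fun i => if jBase k ℓ i ≠ -1 ∧ jBase k ℓ i ≠ 1 then 1 else 0),
      Fin.sum_univ_four]
    rcases hk with rfl | rfl <;> simp [jBase, hl.1, hl.2]
  · unfold OmegaRes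
    rw [Equiv.sum_comp π (fun i => (sigmaBase i : ℝ) * |(jBase k ℓ i : ℝ)| ^ α),
      Fin.sum_univ_four]
    simp [sigmaBase, jBase]

/-- Characterization of the 4-wave resonances with exactly two indices outside
`Λ = {-1,1}`, and the small-divisor lower bound on the non-resonant part of `𝔓²_Λ`. -/
theorem P2_resonances (α : ℝ) (hα₀ : 0 < α) (hα₁ : α < 1) :
    (∀ j σ : Fin 4 → ℤ,
      (inP4 j σ ∧ outsideCount j = 2 ∧ OmegaRes α j σ = 0) ↔
        ∃ π : Equiv.Perm (Fin 4), ∃ k ℓ : ℤ,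
          (k = -1 ∨ k = 1) ∧ (ℓ ≠ -1 ∧ ℓ ≠ 1) ∧
          j = (fun i => jBase k ℓ (π i)) ∧ σ = (fun i => sigmaBase (π i))) ∧
    (∃ c : ℝ, 0 < c ∧ ∀ j σ : Fin 4 → ℤ,
      inP4 j σ → outsideCount j = 2 → OmegaRes α j σ ≠ 0 →
        c / ((Finset.univ.sup fun i => (j i).natAbs : ℕ) : ℝ) ^ (1 - α) ≤
          |OmegaRes α j σ|) := by
  constructor
  · intro j σ
    constructor
    · rintro ⟨h, hc, h0⟩
      rcases dichotomy α hα₀ hα₁ j σ h hc with h | ⟨h1, h2⟩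
      · exact h
      · rw [h0, abs_zero] at h2
        linarith
    · rintro ⟨π, k, ℓ, hk, hl, rfl, rfl⟩
      exact resonant_of_base α π k ℓ hk hl
  · refine ⟨cRes α, cRes_pos α hα₀ hα₁, ?_⟩
    intro j σ h hc h0
    rcases dichotomy α hα₀ hα₁ j σ h hc with ⟨π, k, ℓ, hk, hl, rfl, rfl⟩ | ⟨-, h2⟩
    · exact absurd (resonant_of_base α π k ℓ hk hl).2.2 h0
    · exact h2

end
end

section
/- Let a,b ∈ ℂ and define, for x ∈ ℝ, f(x) := −Im(a·\bar{b}·e^{2ix}) and v(x) := 2Re(a·\bar{b}·e^{2ix}), and set J := (|a|² + |b|²)/2. Then f and v are differentiable with f'(x) = −v(x) and v'(x) = 4f(x), one has the identity f(x)v'(x) − v(x)f'(x) = 4|a|²|b|² for all x, the bound |f'(x)| ≤ 2|a||b| for all x, and consequently f(x)v'(x) − v(x)f'(x) − J·f'(x) ≥ 2|a||b|·(2|a||b| − J) for all x ∈ ℝ. -/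
/-- The escape-function (positive Poisson bracket) inequality: with
`f(x) = -Im(a b̄ e^{2ix})`, `v(x) = 2Re(a b̄ e^{2ix})` and `J = (|a|²+|b|²)/2`,
one has `f' = -v`, `v' = 4f`, `f v' - v f' = 4|a|²|b|²`, `|f'| ≤ 2|a||b|` and
`f v' - v f' - J f' ≥ 2|a||b|(2|a||b| - J)`. -/
theorem escape_function_inequality (a b : ℂ) (f v : ℝ → ℝ) (J : ℝ)
    (hf : ∀ x : ℝ, f x =
      -(a * (starRingEnd ℂ) b * Complex.exp (2 * Complex.I * (x : ℂ))).im)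
    (hv : ∀ x : ℝ, v x =
      2 * (a * (starRingEnd ℂ) b * Complex.exp (2 * Complex.I * (x : ℂ))).re)
    (hJ : J = (‖a‖ ^ 2 + ‖b‖ ^ 2) / 2) :
    (∀ x : ℝ, HasDerivAt f (-(v x)) x) ∧
    (∀ x : ℝ, HasDerivAt v (4 * f x) x) ∧
    (∀ x : ℝ, f x * deriv v x - v x * deriv f x = 4 * ‖a‖ ^ 2 * ‖b‖ ^ 2) ∧
    (∀ x : ℝ, |deriv f x| ≤ 2 * ‖a‖ * ‖b‖) ∧
    (∀ x : ℝ, 2 * ‖a‖ * ‖b‖ * (2 * ‖a‖ * ‖b‖ - J) ≤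
      f x * deriv v x - v x * deriv f x - J * deriv f x) := by
  have hn : (a * (starRingEnd ℂ) b).re ^ 2 + (a * (starRingEnd ℂ) b).im ^ 2
      = (‖a‖ * ‖b‖) ^ 2 := by
    have h1 : ‖a * (starRingEnd ℂ) b‖ = ‖a‖ * ‖b‖ := by
      rw [norm_mul, RCLike.norm_conj]
    rw [← h1, ← Complex.normSq_eq_norm_sq, Complex.normSq_apply]
    ring
  generalize a * (starRingEnd ℂ) b = w at hf hv hn
  have he : ∀ x : ℝ, Complex.exp (2 * Complex.I * (x : ℂ))
      = (⟨Real.cos (2 * x), Real.sin (2 * x)⟩ : ℂ) := by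
    intro x
    have h2 : 2 * Complex.I * (x : ℂ) = ((2 * x : ℝ) : ℂ) * Complex.I := by
      push_cast
      ring
    rw [h2]
    apply Complex.ext
    · exact Complex.exp_ofReal_mul_I_re _
    · exact Complex.exp_ofReal_mul_I_im _
  have hf' : ∀ x, f x = -(w.re * Real.sin (2 * x) + w.im * Real.cos (2 * x)) := by
    intro x
    rw [hf, he, Complex.mul_im]
  have hv' : ∀ x, v x = 2 * (w.re * Real.cos (2 * x) - w.im * Real.sin (2 * x)) := by
    intro x
    rw [hv, he, Complex.mul_re]
  have hl : ∀ x : ℝ, HasDerivAt (fun y : ℝ => 2 * y) 2 x := by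
    intro x
    simpa using (hasDerivAt_id x).const_mul (2 : ℝ)
  have df : ∀ x : ℝ, HasDerivAt f (-(v x)) x := by
    intro x
    rw [funext hf', hv']
    refine ((((hl x).sin.const_mul w.re).add ((hl x).cos.const_mul w.im)).neg).congr_deriv ?_
    ring
  have dv : ∀ x : ℝ, HasDerivAt v (4 * f x) x := by
    intro x
    rw [funext hv', hf']
    refine ((((hl x).cos.const_mul w.re).sub
      ((hl x).sin.const_mul w.im)).const_mul 2).congr_deriv ?_
    ring
  have hid : ∀ x, 4 * f x ^ 2 + v x ^ 2 = 4 * (‖a‖ * ‖b‖) ^ 2 := by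
    intro x
    rw [hf', hv', ← hn]
    linear_combination (4 * (w.re ^ 2 + w.im ^ 2)) * Real.sin_sq_add_cos_sq (2 * x)
  have hb : ∀ x, |v x| ≤ 2 * ‖a‖ * ‖b‖ := by
    intro x
    apply abs_le_of_sq_le_sq _ (by positivity)
    nlinarith [hid x, sq_nonneg (f x)]
  have hJ0 : 0 ≤ J := by rw [hJ]; positivity
  refine ⟨df, dv, ?_, ?_, ?_⟩
  · intro x
    rw [(df x).deriv, (dv x).deriv]
    linear_combination hid x
  · intro x
    rw [(df x).deriv, abs_neg]
    exact hb x
  · intro x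
    rw [(df x).deriv, (dv x).deriv]
    have h3 := mul_le_mul_of_nonneg_left (neg_le_of_abs_le (hb x)) hJ0
    nlinarith [hid x]
end

section
/- Let η : ℝ → ℝ be defined by η(y) = 0 for y ≤ 1, η(y) = e^{−1/(y−1)} / (e^{−1/(y−1)} + e^{−1/(2−y)}) for 1 < y < 2, and η(y) = 1 for y ≥ 2. Then: (a) η is C^∞ on ℝ and nondecreasing (in particular η'(y) ≥ 0 for all y); (b) there exists a C^∞ function g : ℝ → ℝ with g ≥ 0, g(y)² = η'(y) for all y ∈ ℝ, and g = 0 outside [1,2]; (c) there exists a C^∞ function f : ℝ → ℝ with f(y)² = η(y)·y·η'(y) for all y ∈ ℝ and f = 0 outside [1,2]. -/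
noncomputable section

/-- The smooth cut-off `η`: `0` for `y ≤ 1`,
`e^{-1/(y-1)} / (e^{-1/(y-1)} + e^{-1/(2-y)})` for `1 < y < 2`, and `1` for `y ≥ 2`. -/
def etaCut (y : ℝ) : ℝ :=
  if y ≤ 1 then 0
  else if y < 2 then
    Real.exp (-(1 / (y - 1))) / (Real.exp (-(1 / (y - 1))) + Real.exp (-(1 / (2 - y))))
  else 1

theorem eta_eq (y : ℝ) : etaCut y = Real.smoothTransition (y - 1) := by
  unfold etaCut
  split_ifs with h1 h2
  · rw [Real.smoothTransition.zero_of_nonpos (by linarith)]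
  · have e1 : ¬ (y - 1 ≤ 0) := by linarith
    have e2 : ¬ (1 - (y - 1) ≤ 0) := by linarith
    have e3 : 1 - (y - 1) = 2 - y := by ring
    rw [Real.smoothTransition, expNegInvGlue, expNegInvGlue, if_neg e1, if_neg e2, e3,
      one_div, one_div]
  · rw [Real.smoothTransition.one_of_one_le (by linarith)]

theorem glue_sq (x : ℝ) : expNegInvGlue (2 * x) ^ 2 = expNegInvGlue x := by
  unfold expNegInvGlue
  by_cases h : x ≤ 0
  · rw [if_pos h, if_pos (by linarith)]; norm_num
  · rw [if_neg h, if_neg (by linarith), ← Real.exp_nat_mul]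
    congr 1
    have : x ≠ 0 := by intro h'; exact h h'.le
    push_cast
    field_simp

theorem glue_deriv (x : ℝ) : HasDerivAt expNegInvGlue (x⁻¹ ^ 2 * expNegInvGlue x) x := by
  simpa using expNegInvGlue.hasDerivAt_polynomial_eval_inv_mul 1 x

/-- a smooth square root of the derivative of `expNegInvGlue` -/
def glueRoot (x : ℝ) : ℝ := x⁻¹ * expNegInvGlue (2 * x)

theorem glueRoot_contDiff : ContDiff ℝ (⊤ : ℕ∞) glueRoot := by
  have h := (expNegInvGlue.contDiff_polynomial_eval_inv_mul (n := ⊤)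
    (Polynomial.C 2 * Polynomial.X)).comp (contDiff_const.mul contDiff_id :
      ContDiff ℝ (⊤ : ℕ∞) (fun x : ℝ => (2 : ℝ) * x))
  have key : glueRoot = (fun x : ℝ => Polynomial.eval x⁻¹ (Polynomial.C 2 * Polynomial.X) *
      expNegInvGlue x) ∘ fun x => 2 * x := by
    funext x
    simp [glueRoot]
    left
    ring
  rw [key]
  exact h

theorem glueRoot_nonneg (x : ℝ) : 0 ≤ glueRoot x := by
  unfold glueRoot
  rcases le_or_gt x 0 with h | h
  · rw [expNegInvGlue.zero_of_nonpos (by linarith)]; simp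
  · exact mul_nonneg (inv_nonneg.2 h.le) (expNegInvGlue.nonneg _)

theorem glueRoot_zero {x : ℝ} (h : x ≤ 0) : glueRoot x = 0 := by
  unfold glueRoot
  rw [expNegInvGlue.zero_of_nonpos (by linarith), mul_zero]

theorem eta_hasDerivAt (y : ℝ) : HasDerivAt etaCut
    (expNegInvGlue (y - 1) * expNegInvGlue (2 - y) * ((y - 1)⁻¹ ^ 2 + (2 - y)⁻¹ ^ 2) /
      (expNegInvGlue (y - 1) + expNegInvGlue (2 - y)) ^ 2) y := by
  have e : etaCut = fun y => expNegInvGlue (y - 1) /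
      (expNegInvGlue (y - 1) + expNegInvGlue (2 - y)) := by
    ext z
    rw [eta_eq, Real.smoothTransition, show 1 - (z - 1) = 2 - z by ring]
  have hp := Real.smoothTransition.pos_denom (y - 1)
  rw [show 1 - (y - 1) = 2 - y by ring] at hp
  have h1 : HasDerivAt (fun y => expNegInvGlue (y - 1))
      ((y - 1)⁻¹ ^ 2 * expNegInvGlue (y - 1) * 1) y :=
    HasDerivAt.comp (h₂ := expNegInvGlue) (h := fun y : ℝ => y - 1) y
      (glue_deriv (y - 1)) ((hasDerivAt_id y).sub_const 1)
  have h2 : HasDerivAt (fun y => expNegInvGlue (2 - y))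
      ((2 - y)⁻¹ ^ 2 * expNegInvGlue (2 - y) * (-1)) y :=
    HasDerivAt.comp (h₂ := expNegInvGlue) (h := fun y : ℝ => 2 - y) y
      (glue_deriv (2 - y)) ((hasDerivAt_id y).const_sub 2)
  rw [e]
  refine (h1.div (h1.add h2) hp.ne').congr_deriv ?_
  simp only [Pi.add_apply]
  congr 1
  ring

/-- the square root of `η'` -/
def gRoot (y : ℝ) : ℝ :=
  glueRoot (y - 1) * glueRoot (2 - y) * Real.sqrt ((y - 1) ^ 2 + (2 - y) ^ 2) /
    (expNegInvGlue (y - 1) + expNegInvGlue (2 - y))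

theorem den_pos (y : ℝ) : 0 < expNegInvGlue (y - 1) + expNegInvGlue (2 - y) := by
  have hp := Real.smoothTransition.pos_denom (y - 1)
  rwa [show 1 - (y - 1) = 2 - y by ring] at hp

theorem sub_one_contDiff : ContDiff ℝ (⊤ : ℕ∞) (fun y : ℝ => y - 1) :=
  contDiff_id.sub contDiff_const

theorem two_sub_contDiff : ContDiff ℝ (⊤ : ℕ∞) (fun y : ℝ => 2 - y) :=
  contDiff_const.sub contDiff_id

theorem den_contDiff : ContDiff ℝ (⊤ : ℕ∞)
    (fun y : ℝ => expNegInvGlue (y - 1) + expNegInvGlue (2 - y)) :=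
  (expNegInvGlue.contDiff.comp sub_one_contDiff).add
    (expNegInvGlue.contDiff.comp two_sub_contDiff)

theorem gRoot_contDiff : ContDiff ℝ (⊤ : ℕ∞) gRoot := by
  refine ContDiff.div (((glueRoot_contDiff.comp sub_one_contDiff).mul
    (glueRoot_contDiff.comp two_sub_contDiff)).mul (ContDiff.sqrt
      ((sub_one_contDiff.pow 2).add (two_sub_contDiff.pow 2)) ?_)) den_contDiff
      (fun y => (den_pos y).ne')
  intro y
  nlinarith [sq_nonneg (2 * y - 3)]

theorem gRoot_nonneg (y : ℝ) : 0 ≤ gRoot y :=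
  div_nonneg (mul_nonneg (mul_nonneg (glueRoot_nonneg _) (glueRoot_nonneg _))
    (Real.sqrt_nonneg _)) (den_pos y).le

theorem gRoot_zero {y : ℝ} (h : y ≤ 1 ∨ 2 ≤ y) : gRoot y = 0 := by
  unfold gRoot
  rcases h with h | h
  · rw [glueRoot_zero (show y - 1 ≤ 0 by linarith)]; simp
  · rw [glueRoot_zero (show 2 - y ≤ 0 by linarith)]; simp

theorem gRoot_sq (y : ℝ) : gRoot y ^ 2 = deriv etaCut y := by
  rw [(eta_hasDerivAt y).deriv]
  by_cases h1 : y ≤ 1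
  · rw [gRoot_zero (Or.inl h1), expNegInvGlue.zero_of_nonpos (show y - 1 ≤ 0 by linarith)]; simp
  by_cases h2 : 2 ≤ y
  · rw [gRoot_zero (Or.inr h2), expNegInvGlue.zero_of_nonpos (show 2 - y ≤ 0 by linarith)]; simp
  unfold gRoot glueRoot
  rw [div_pow, mul_pow, mul_pow, mul_pow, mul_pow, glue_sq, glue_sq,
    Real.sq_sqrt (by positivity)]
  congr 1
  have a1 : y - 1 ≠ 0 := by intro h; apply h1; linarith
  have a2 : 2 - y ≠ 0 := by intro h; apply h2; linarith
  field_simp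
  ring

/-- the square root of `η y η'` -/
def fRoot (y : ℝ) : ℝ :=
  gRoot y * expNegInvGlue (2 * (y - 1)) * Real.sqrt y /
    Real.sqrt (expNegInvGlue (y - 1) + expNegInvGlue (2 - y))

theorem fRoot_zero {y : ℝ} (h : y ≤ 1 ∨ 2 ≤ y) : fRoot y = 0 := by
  unfold fRoot
  rw [gRoot_zero h]; simp

theorem fRoot_contDiff : ContDiff ℝ (⊤ : ℕ∞) fRoot := by
  rw [contDiff_iff_contDiffAt]
  intro y
  rcases lt_or_ge y 1 with h | h
  · refine (contDiffAt_const (c := (0 : ℝ))).congr_of_eventuallyEq ?_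
    filter_upwards [gt_mem_nhds h] with z hz
    exact fRoot_zero (Or.inl hz.le)
  · refine ContDiffAt.div (((gRoot_contDiff.mul (expNegInvGlue.contDiff.comp
      (contDiff_const.mul sub_one_contDiff))).contDiffAt).mul
      (Real.contDiffAt_sqrt (by linarith))) ?_ ?_
    · exact (den_contDiff.sqrt (fun y => (den_pos y).ne')).contDiffAt
    · exact (Real.sqrt_pos.2 (den_pos y)).ne'

theorem fRoot_sq (y : ℝ) : fRoot y ^ 2 = etaCut y * y * deriv etaCut y := by
  rw [← gRoot_sq]
  by_cases h1 : y ≤ 1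
  · rw [fRoot_zero (Or.inl h1), gRoot_zero (Or.inl h1)]; simp
  unfold fRoot
  rw [div_pow, mul_pow, mul_pow, glue_sq, Real.sq_sqrt (den_pos y).le,
    Real.sq_sqrt (by linarith), eta_eq, Real.smoothTransition, show 1 - (y - 1) = 2 - y by ring]
  ring

/-- `η` is smooth and nondecreasing, `η'` has a smooth nonnegative square root
supported in `[1,2]`, and `η·y·η'` has a smooth square root supported in `[1,2]`. -/
theorem etaCut_properties :
    ContDiff ℝ (⊤ : ℕ∞) etaCut ∧
    Monotone etaCut ∧
    (∀ y : ℝ, 0 ≤ deriv etaCut y) ∧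
    (∃ g : ℝ → ℝ, ContDiff ℝ (⊤ : ℕ∞) g ∧ (∀ y, 0 ≤ g y) ∧
      (∀ y : ℝ, g y ^ 2 = deriv etaCut y) ∧
      (∀ y : ℝ, y ∉ Set.Icc (1 : ℝ) 2 → g y = 0)) ∧
    (∃ f : ℝ → ℝ, ContDiff ℝ (⊤ : ℕ∞) f ∧
      (∀ y : ℝ, f y ^ 2 = etaCut y * y * deriv etaCut y) ∧
      (∀ y : ℝ, y ∉ Set.Icc (1 : ℝ) 2 → f y = 0)) := by
  have hout : ∀ y : ℝ, y ∉ Set.Icc (1 : ℝ) 2 → y ≤ 1 ∨ 2 ≤ y := by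
    intro y hy
    by_contra! h
    exact hy ⟨h.1.le, h.2.le⟩
  refine ⟨?_, ?_, ?_, ⟨gRoot, gRoot_contDiff, gRoot_nonneg, gRoot_sq,
    fun y hy => gRoot_zero (hout y hy)⟩, ⟨fRoot, fRoot_contDiff, fRoot_sq,
    fun y hy => fRoot_zero (hout y hy)⟩⟩
  · rw [show etaCut = fun y => Real.smoothTransition (y - 1) from funext eta_eq]
    exact Real.smoothTransition.contDiff.comp sub_one_contDiff
  · intro a b hab
    rw [eta_eq, eta_eq]
    exact Real.smoothTransition.monotone (by linarith)
  · intro y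
    rw [← gRoot_sq]
    positivity

end
end

section
/- Let α ∈ (0,1) and let (j₁,j₂,j,k) ∈ ℤ⁴ satisfy j₁ − j₂ + j = k, and suppose that the tuple ((j₁,j₂,j,k),(1,−1,1,−1)) belongs to 𝔕^{(0)}_Λ ∪ 𝔕^{(1)}_Λ ∪ 𝔕^{(2)}_Λ. Then either j₁ = j₂, or max(|j₁|,|j₂|) > (1/10)·max(1, |j+k|/2). Consequently, for any paradifferential cut-off χ₂ vanishing whenever max(|ξ₁|,|ξ₂|) ≥ (1/10)·max(1,|ξ|) and any zero-average quadratic symbol (one whose coefficients a_{j₁,j₂} vanish for j₁ = j₂), every monomial χ₂(j₁,j₂,(j+k)/2)·a_{j₁,j₂}((j+k)/2)·z_{j₁}\bar{z_{j₂}}z_j e^{ikx} of the associated paraproduct vector field indexed by a 4-wave resonance with at most two indices outside Λ vanishes. -/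
noncomputable section

/-- The 4-wave resonance function with sign pattern `(+,-,+,-)`:
`Ω_α(j₁,j₂,j₃,j₄) = |j₁|^α - |j₂|^α + |j₃|^α - |j₄|^α`. -/
def Omega4 (α : ℝ) (j₁ j₂ j₃ j₄ : ℤ) : ℝ :=
  |(j₁ : ℝ)| ^ α - |(j₂ : ℝ)| ^ α + |(j₃ : ℝ)| ^ α - |(j₄ : ℝ)| ^ α

/-- On any 4-wave resonance `(j₁,j₂,j,k)` (sign pattern `(+,-,+,-)`, momentum
`j₁-j₂+j=k`) with at most two indices outside `Λ = {-1,1}`, either `j₁ = j₂` or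
`max(|j₁|,|j₂|) > (1/10)·max(1,|j+k|/2)`; consequently every monomial of a
zero-average quadratic paraproduct vector field indexed by such a resonance vanishes. -/
theorem resonances_killed_by_paradifferential_cutoff
    (α : ℝ) (hα₀ : 0 < α) (hα₁ : α < 1)
    (j₁ j₂ j k : ℤ) (hmom : j₁ - j₂ + j = k)
    (hres : Omega4 α j₁ j₂ j k = 0)
    (hcount :
      (if j₁ ≠ -1 ∧ j₁ ≠ 1 then (1 : ℕ) else 0) +
        (if j₂ ≠ -1 ∧ j₂ ≠ 1 then (1 : ℕ) else 0) +
        (if j ≠ -1 ∧ j ≠ 1 then (1 : ℕ) else 0) +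
        (if k ≠ -1 ∧ k ≠ 1 then (1 : ℕ) else 0) ≤ 2) :
    (j₁ = j₂ ∨
      (1 : ℝ) / 10 * max 1 (|((j + k : ℤ) : ℝ)| / 2) < max |(j₁ : ℝ)| |(j₂ : ℝ)|) ∧
    (∀ χ₂ : ℝ → ℝ → ℝ → ℝ,
      (∀ ξ₁ ξ₂ ξ : ℝ, (1 : ℝ) / 10 * max 1 |ξ| ≤ max |ξ₁| |ξ₂| → χ₂ ξ₁ ξ₂ ξ = 0) →
      ∀ acoef : ℤ → ℤ → ℝ → ℂ,
        (∀ j' : ℤ, ∀ ξ : ℝ, acoef j' j' ξ = 0) →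
        ∀ z : ℤ → ℂ, ∀ x : ℝ,
          Complex.ofReal (χ₂ (j₁ : ℝ) (j₂ : ℝ) (((j + k : ℤ) : ℝ) / 2)) *
            acoef j₁ j₂ (((j + k : ℤ) : ℝ) / 2) * z j₁ * (starRingEnd ℂ) (z j₂) * z j *
            Complex.exp (Complex.I * (k : ℂ) * (x : ℂ)) = 0) := by
  have hM1 : |j₁| ≤ max |j₁| |j₂| := le_max_left _ _
  have hM2 : |j₂| ≤ max |j₁| |j₂| := le_max_right _ _
  have key : j₁ = j₂ ∨ (1 ≤ max |j₁| |j₂| ∧ |j + k| < 20 * max |j₁| |j₂|) := by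
    by_cases h12 : j₁ = j₂
    · exact Or.inl h12
    right
    generalize max |j₁| |j₂| = M at hM1 hM2 ⊢
    rw [abs_le] at hM1 hM2
    have hM : 1 ≤ M := by omega
    refine ⟨hM, ?_⟩
    by_contra hcon
    rw [not_lt, le_abs] at hcon
    have hj : j ≠ -1 ∧ j ≠ 1 := by omega
    have hk : k ≠ -1 ∧ k ≠ 1 := by omega
    rw [if_pos hj, if_pos hk] at hcount
    have h1 : j₁ = -1 ∨ j₁ = 1 := by
      by_contra h
      rw [if_pos (by omega)] at hcount
      omega
    have h2 : j₂ = -1 ∨ j₂ = 1 := by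
      by_contra h
      rw [if_pos (c := j₂ ≠ -1 ∧ j₂ ≠ 1) (by omega)] at hcount
      omega
    have e1 : |(j₁ : ℝ)| = 1 := by rcases h1 with h | h <;> simp [h]
    have e2 : |(j₂ : ℝ)| = 1 := by rcases h2 with h | h <;> simp [h]
    unfold Omega4 at hres
    rw [e1, e2] at hres
    have hpow : |(j : ℝ)| ^ α = |(k : ℝ)| ^ α := by linarith
    have habs : |(j : ℝ)| = |(k : ℝ)| :=
      (Real.rpow_left_inj (abs_nonneg _) (abs_nonneg _) hα₀.ne').1 hpow
    have hjk : j = k ∨ j = -k := by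
      rcases abs_eq_abs.1 habs with h | h
      · left; exact_mod_cast h
      · right; exact_mod_cast h
    omega
  have first : j₁ = j₂ ∨
      (1 : ℝ) / 10 * max 1 (|((j + k : ℤ) : ℝ)| / 2) < max |(j₁ : ℝ)| |(j₂ : ℝ)| := by
    rcases key with h | ⟨ha, hb⟩
    · exact Or.inl h
    right
    have ha' : (1 : ℝ) ≤ max |(j₁ : ℝ)| |(j₂ : ℝ)| := by exact_mod_cast ha
    have hb' : |((j + k : ℤ) : ℝ)| < 20 * max |(j₁ : ℝ)| |(j₂ : ℝ)| := by exact_mod_cast hb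
    have : max 1 (|((j + k : ℤ) : ℝ)| / 2) < 10 * max |(j₁ : ℝ)| |(j₂ : ℝ)| :=
      max_lt (by linarith) (by linarith)
    linarith
  refine ⟨first, ?_⟩
  intro χ₂ hχ acoef hacoef z x
  rcases first with h | h
  · subst h
    simp [hacoef]
  · have hab : |((j + k : ℤ) : ℝ) / 2| = |((j + k : ℤ) : ℝ)| / 2 := by
      rw [abs_div, abs_two]
    rw [hχ (j₁ : ℝ) (j₂ : ℝ) (((j + k : ℤ) : ℝ) / 2) (by rw [hab]; exact h.le)]
    simp

end
end
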